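/- Let G be a finite simple graph on n vertices, let F_q be a finite field with q elements, and let M be an n×n matrix over F_q with rows and columns indexed by the vertices of G such that every diagonal entry of M is nonzero and M_{uv} = 0 whenever u ≠ v and u is not adjacent to v in G. Then there is a guessing strategy for (G,q) whose set of winning assignments is exactly the set of solutions X ∈ F_q^n of MX = 0, which has cardinality q^{n − rank(M)}; consequently N(G,q) ≥ q^{n − rank(M)}, i.e., gn(G,q) ≥ n − rank(M). -/

import Mathlib

/-- A guessing strategy on graph `G` with alphabet `A`: each player `v` maps the
values of its neighbours to a guess of its own value. -/
def GuessStrategy {V : Type*} (G : SimpleGraph V) (A : Type*) : Type _ :=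
  ∀ v : V, ((G.neighborSet v) → A) → A

/-- An assignment `a : V → A` is winning for the strategy `F` if every player
guesses its own value correctly. -/
def WinningAssignment {V : Type*} {G : SimpleGraph V} {A : Type*}
    (F : GuessStrategy G A) (a : V → A) : Prop :=
  ∀ v : V, F v (fun u => a u.1) = a v

/-- The number of assignments won by strategy `F` in the game `(G, s)`. -/
noncomputable def winCount {V : Type*} (G : SimpleGraph V) (s : ℕ)
    (F : GuessStrategy G (Fin s)) : ℕ :=
  Nat.card {a : V → Fin s // WinningAssignment F a}

/-- `N(G,s)`: the maximum number of winning assignments over all strategies. -/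
noncomputable def maxWinCount {V : Type*} (G : SimpleGraph V) (s : ℕ) : ℕ :=
  sSup {n | ∃ F : GuessStrategy G (Fin s), winCount G s F = n}

/-- The guessing number `gn(G,s) = log_s N(G,s)`. -/
noncomputable def gn {V : Type*} (G : SimpleGraph V) (s : ℕ) : ℝ :=
  Real.logb s (maxWinCount G s)

/-- The `t`-uniform blowup of `G`. -/
def blowup {V : Type*} (G : SimpleGraph V) (t : ℕ) : SimpleGraph (V × Fin t) :=
  G.comap Prod.fst

namespace GuessStrategy

/-- Relabel the alphabet of a guessing strategy along a bijection. -/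
def relabel {V A B : Type*} {G : SimpleGraph V} (e : A ≃ B) (S : GuessStrategy G A) :
    GuessStrategy G B :=
  fun v x => e (S v fun u => e.symm (x u))

theorem winningAssignment_relabel_iff {V A B : Type*} {G : SimpleGraph V} (e : A ≃ B)
    (S : GuessStrategy G A) (a : V → A) :
    WinningAssignment (S.relabel e) (fun v => e (a v)) ↔ WinningAssignment S a := by
  simp [WinningAssignment, relabel]

open Classical in
/-- The strategy in which each vertex `v` solves the `v`-th row of `M *ᵥ X = 0` for `X v`. -/
noncomputable def ofMatrix {V F : Type*} [Fintype V] [Field F] (G : SimpleGraph V)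
    (M : Matrix V V F) : GuessStrategy G F :=
  fun v x => -(M v v)⁻¹ * ∑ u, if h : G.Adj v u then M v u * x ⟨u, h⟩ else 0

theorem winningAssignment_ofMatrix_iff {V F : Type*} [Fintype V] [Field F] {G : SimpleGraph V}
    {M : Matrix V V F} (hdiag : ∀ v, M v v ≠ 0)
    (hoff : ∀ u v, u ≠ v → ¬ G.Adj u v → M u v = 0) (a : V → F) :
    WinningAssignment (ofMatrix G M) a ↔ M.mulVec a = 0 := by
  classical
  rw [funext_iff]
  refine forall_congr' fun v => ?_
  have hsum : (∑ u, if G.Adj v u then M v u * a u else 0) + M v v * a v = M.mulVec a v := by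
    rw [← Finset.sum_erase (f := fun u => if G.Adj v u then M v u * a u else 0) Finset.univ
        (if_neg (G.irrefl (v := v))),
      Matrix.mulVec, dotProduct, ← Finset.sum_erase_add _ _ (Finset.mem_univ v)]
    congr 1
    refine Finset.sum_congr rfl fun u hu => ?_
    split_ifs with h
    · rfl
    · rw [hoff v u (Finset.ne_of_mem_erase hu).symm h, zero_mul]
  have hv := hdiag v
  simp only [ofMatrix, dite_eq_ite, Pi.zero_apply, ← hsum]
  generalize (∑ u, if G.Adj v u then M v u * a u else 0) = c
  rw [neg_mul, neg_eq_iff_eq_neg, inv_mul_eq_iff_eq_mul₀ hv, mul_neg, eq_neg_iff_add_eq_zero]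

end GuessStrategy

theorem winCount_le_maxWinCount {V : Type*} [Finite V] (G : SimpleGraph V) (s : ℕ)
    (S : GuessStrategy G (Fin s)) : winCount G s S ≤ maxWinCount G s := by
  refine le_csSup ⟨Nat.card (V → Fin s), ?_⟩ ⟨S, rfl⟩
  rintro _ ⟨T, rfl⟩
  exact Finite.card_subtype_le _

theorem card_winningAssignment_le_maxWinCount {V A : Type*} [Finite V] [Fintype A]
    {G : SimpleGraph V} (S : GuessStrategy G A) :
    Nat.card {a : V → A // WinningAssignment S a} ≤ maxWinCount G (Fintype.card A) := by
  let e := Fintype.equivFin A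
  refine le_of_eq_of_le ?_ (winCount_le_maxWinCount G _ (S.relabel e))
  exact Nat.card_congr ((Equiv.arrowCongr (Equiv.refl V) e).subtypeEquiv fun a =>
    (S.winningAssignment_relabel_iff e a).symm)

theorem Matrix.card_mulVec_eq_zero {m n F : Type*} [Fintype m] [Fintype n] [Field F] [Fintype F]
    (M : Matrix m n F) :
    Nat.card {X : n → F | M.mulVec X = 0} = Fintype.card F ^ (Fintype.card n - M.rank) := by
  have hrank := M.mulVecLin.finrank_range_add_finrank_ker
  rw [Module.finrank_fintype_fun_eq_card] at hrank
  have hker : Module.finrank F (LinearMap.ker M.mulVecLin) = Fintype.card n - M.rank :=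
    Nat.eq_sub_of_add_eq' hrank
  rw [← hker, ← Nat.card_eq_fintype_card (α := F), ← Module.natCard_eq_pow_finrank (K := F)]
  rfl

/-- If M is a matrix over a finite field F_q representing the graph G
(nonzero diagonal, and zero off-diagonal entries between non-adjacent vertices), then
there is a guessing strategy for (G,q) whose winning assignments are exactly the
solutions of MX = 0; there are q^(n − rank M) of those, so N(G,q) ≥ q^(n − rank M),
i.e. gn(G,q) ≥ n − rank M. -/
theorem guessing_number_ge_of_representing_matrix {V : Type*} [Fintype V] [DecidableEq V]
    {F : Type*} [Field F] [Fintype F] (G : SimpleGraph V) (M : Matrix V V F)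
    (hdiag : ∀ v : V, M v v ≠ 0)
    (hoff : ∀ u v : V, u ≠ v → ¬ G.Adj u v → M u v = 0) :
    (∃ S : GuessStrategy G F,
        {a : V → F | WinningAssignment S a} = {X : V → F | M.mulVec X = 0}) ∧
      Nat.card {X : V → F | M.mulVec X = 0} =
        Fintype.card F ^ (Fintype.card V - M.rank) ∧
      Fintype.card F ^ (Fintype.card V - M.rank) ≤ maxWinCount G (Fintype.card F) ∧
      (Fintype.card V : ℝ) - (M.rank : ℝ) ≤ gn G (Fintype.card F) := by
  have hwin := GuessStrategy.winningAssignment_ofMatrix_iff hdiag hoff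
  have hcard := M.card_mulVec_eq_zero
  have hmax : Fintype.card F ^ (Fintype.card V - M.rank) ≤ maxWinCount G (Fintype.card F) := by
    rw [← hcard]
    exact (Nat.card_congr (Equiv.subtypeEquivRight hwin)).symm.trans_le
      (card_winningAssignment_le_maxWinCount (GuessStrategy.ofMatrix G M))
  refine ⟨⟨GuessStrategy.ofMatrix G M, Set.ext hwin⟩, hcard, hmax, ?_⟩
  have hq : 1 < Fintype.card F := Fintype.one_lt_card
  have hpos : 0 < maxWinCount G (Fintype.card F) := (pow_pos (by omega) _).trans_le hmax
  rw [gn, Real.le_logb_iff_rpow_le (by exact_mod_cast hq) (by exact_mod_cast hpos),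
    ← Nat.cast_sub M.rank_le_card_width, Real.rpow_natCast]
  exact_mod_cast hmax
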